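/- Let u be harmonic and bounded by 1 in absolute value on 𝕋 × (c, ∞), 1-periodic in x. Then u admits the Fourier representation u(x,y) = a₀ + Σ_{k≥1} (a_k sin(2πkx) + b_k cos(2πkx)) e^{−2πk(y−c)}, and all derivatives of u − a₀ decay exponentially as y → ∞. -/

import Mathlib

set_option autoImplicit false

open Set Real

open Filter Topology MeasureTheory

/-! ### Bounded solutions of a linear second order equation on a half-line -/

lemma exists_const_of_hasDerivAt_zero_Ioi {c : ℝ} {f : ℝ → ℂ}
    (hf : ∀ y, c < y → HasDerivAt f 0 y) : ∃ K : ℂ, ∀ y, c < y → f y = K := by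
  obtain ⟨K, hK⟩ := isOpen_Ioi.exists_is_const_of_deriv_eq_zero (s := Ioi c) (f := f)
    isPreconnected_Ioi (fun y hy => (hf y hy).differentiableAt.differentiableWithinAt)
    (fun y hy => (hf y hy).deriv)
  exact ⟨K, fun y hy => hK y hy⟩

lemma hasDerivAt_ofReal_exp (l c y : ℝ) :
    HasDerivAt (fun y : ℝ => ((exp (l * (y - c)) : ℝ) : ℂ)) (l * (exp (l * (y - c)) : ℝ)) y := by
  have h : HasDerivAt (fun y : ℝ => exp (l * (y - c))) (exp (l * (y - c)) * (l * 1)) y :=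
    (((hasDerivAt_id y).sub_const c).const_mul l).exp
  convert h.ofReal_comp using 1
  push_cast
  ring

lemma eq_exp_of_hasDerivAt_of_bounded {c l : ℝ} (hl : 0 < l) {f f' : ℝ → ℂ}
    (hf : ∀ y, c < y → HasDerivAt f (f' y) y)
    (hf' : ∀ y, c < y → HasDerivAt f' ((l : ℂ) ^ 2 * f y) y)
    (hb : ∀ y, c < y → ‖f y‖ ≤ 1) :
    ∃ d : ℂ, ‖d‖ ≤ 1 ∧ ∀ y, c < y → f y = d * (exp (-l * (y - c)) : ℝ) := by
  have hlC : (l : ℂ) ≠ 0 := by exact_mod_cast hl.ne'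
  have hmul (p q y : ℝ) : ((exp (p * (y - c)) : ℝ) : ℂ) * (exp (q * (y - c)) : ℝ)
      = (exp ((p + q) * (y - c)) : ℝ) := by
    rw [← Complex.ofReal_mul, ← Real.exp_add, add_mul]
  obtain ⟨K, hK⟩ := exists_const_of_hasDerivAt_zero_Ioi (c := c)
    (f := fun y => (f' y + l * f y) * (exp (-l * (y - c)) : ℝ)) (fun y hy => by
      refine (((hf' y hy).add ((hf y hy).const_mul (l : ℂ))).mul
        (hasDerivAt_ofReal_exp (-l) c y)).congr_deriv ?_
      simp only [Pi.add_apply]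
      push_cast
      ring)
  have hK' : ∀ y, c < y → f' y + l * f y = K * (exp (l * (y - c)) : ℝ) := fun y hy => by
    rw [← hK y hy, mul_assoc, hmul]
    simp
  obtain ⟨D, hD⟩ := exists_const_of_hasDerivAt_zero_Ioi (c := c)
    (f := fun y => f y * (exp (l * (y - c)) : ℝ) - K / (2 * l) * (exp ((l + l) * (y - c)) : ℝ))
    (fun y hy => by
      refine (((hf y hy).mul (hasDerivAt_ofReal_exp l c y)).sub
        ((hasDerivAt_ofReal_exp (l + l) c y).const_mul (K / (2 * l)))).congr_deriv ?_
      have h1 : f' y = K * (exp (l * (y - c)) : ℝ) - l * f y := by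
        rw [← hK' y hy]; ring
      rw [h1, ← hmul l l y]
      push_cast
      field_simp
      ring)
  have hform : ∀ y, c < y →
      f y * (exp (-l * (y - c)) : ℝ) - D * (exp ((-l + -l) * (y - c)) : ℝ) = K / (2 * l) := by
    intro y hy
    rw [← hD y hy, sub_mul, mul_assoc (f y), hmul, mul_assoc (K / (2 * l)), hmul]
    ring_nf
    simp
  have htend (p : ℝ) (hp : 0 < p) :
      Tendsto (fun y => exp (-p * (y - c))) atTop (𝓝 0) := by
    refine Real.tendsto_exp_atBot.comp ?_
    exact (tendsto_atTop_add_const_right _ (-c) tendsto_id).const_mul_atTop_of_neg (by linarith)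
  have hK0 : K / (2 * l) = 0 := by
    refine tendsto_nhds_unique (f := fun _ : ℝ => K / (2 * (l : ℂ))) (l := atTop)
      tendsto_const_nhds ?_
    have h1 : Tendsto (fun y => f y * ((exp (-l * (y - c)) : ℝ) : ℂ)) atTop (𝓝 0) := by
      refine squeeze_zero_norm' ?_ (htend l hl)
      filter_upwards [eventually_gt_atTop c] with y hy
      rw [norm_mul, Complex.norm_real, Real.norm_of_nonneg (exp_pos _).le]
      exact mul_le_of_le_one_left (exp_pos _).le (hb y hy)
    have h2 : Tendsto (fun y => D * ((exp ((-l + -l) * (y - c)) : ℝ) : ℂ)) atTop (𝓝 0) := by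
      have := (Complex.continuous_ofReal.tendsto 0).comp (htend (l + l) (by linarith))
      simpa [Function.comp_def, neg_add] using this.const_mul D
    have h3 := h1.sub h2
    rw [sub_zero] at h3
    refine h3.congr' ?_
    filter_upwards [eventually_gt_atTop c] with y hy
    exact hform y hy
  have hD' : ∀ y, c < y → f y * (exp (l * (y - c)) : ℝ) = D := fun y hy => by
    have := hD y hy
    rwa [hK0, zero_mul, sub_zero] at this
  refine ⟨D, ?_, fun y hy => ?_⟩
  · have hlim : Tendsto (fun y => exp (l * (y - c))) (𝓝[>] c) (𝓝 1) := by
      have : Continuous fun y => exp (l * (y - c)) := by fun_prop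
      simpa using (this.tendsto c).mono_left nhdsWithin_le_nhds
    refine ge_of_tendsto hlim ?_
    filter_upwards [self_mem_nhdsWithin] with y hy
    rw [← hD' y hy, norm_mul, Complex.norm_real, Real.norm_of_nonneg (exp_pos _).le]
    exact mul_le_of_le_one_left (exp_pos _).le (hb y hy)
  · rw [← hD' y hy, mul_assoc, hmul]
    simp

lemma eq_const_of_hasDerivAt_of_bounded {c : ℝ} {f f' : ℝ → ℂ}
    (hf : ∀ y, c < y → HasDerivAt f (f' y) y) (hf' : ∀ y, c < y → HasDerivAt f' 0 y)
    (hb : ∀ y, c < y → ‖f y‖ ≤ 1) :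
    ∃ d : ℂ, ‖d‖ ≤ 1 ∧ ∀ y, c < y → f y = d := by
  obtain ⟨K, hK⟩ := exists_const_of_hasDerivAt_zero_Ioi hf'
  obtain ⟨D, hD⟩ := exists_const_of_hasDerivAt_zero_Ioi (c := c) (f := fun y => f y - K * (y : ℂ))
    (fun y hy => by
      refine ((hf y hy).sub ((hasDerivAt_id y).ofReal_comp.const_mul K)).congr_deriv ?_
      simp [hK y hy])
  have hK0 : K = 0 := by
    refine tendsto_nhds_unique (f := fun _ : ℝ => K) (l := atTop) tendsto_const_nhds ?_
    have h : Tendsto (fun y : ℝ => (1 + ‖D‖) * y⁻¹) atTop (𝓝 0) := by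
      simpa using tendsto_inv_atTop_zero.const_mul (1 + ‖D‖)
    refine squeeze_zero_norm' ?_ h
    filter_upwards [eventually_gt_atTop c, eventually_gt_atTop 0] with y hy hy0
    rw [le_mul_inv_iff₀ hy0]
    have h1 : K * (y : ℂ) = f y - D := by rw [← hD y hy]; ring
    calc ‖K‖ * y = ‖K * (y : ℂ)‖ := by
          rw [norm_mul, Complex.norm_real, Real.norm_of_nonneg hy0.le]
      _ ≤ ‖f y‖ + ‖D‖ := by rw [h1]; exact norm_sub_le _ _
      _ ≤ 1 + ‖D‖ := by gcongr; exact hb y hy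
  have hD' : ∀ y, c < y → f y = D := fun y hy => by simpa [hK0] using hD y hy
  exact ⟨D, hD' (c + 1) (by linarith) ▸ hb (c + 1) (by linarith), hD'⟩

/-! ### Partial derivatives on a half-plane and integrals over a period -/

lemma hasDerivAt_integral_mul_of_continuousOn {c : ℝ} {g g' : ℝ → ℝ → ℝ} {w : ℝ → ℂ}
    (hw : Continuous w)
    (hg : ContinuousOn (Function.uncurry g) (univ ×ˢ Ioi c))
    (hg' : ContinuousOn (Function.uncurry g') (univ ×ˢ Ioi c))
    (hgd : ∀ x y, c < y → HasDerivAt (fun t => g x t) (g' x y) y) {y : ℝ} (hy : c < y) :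
    HasDerivAt (fun y => ∫ x in (0 : ℝ)..1, w x * g x y) (∫ x in (0 : ℝ)..1, w x * g' x y) y := by
  have hslice {h : ℝ → ℝ → ℝ} (hh : ContinuousOn (Function.uncurry h) (univ ×ˢ Ioi c))
      {t : ℝ} (ht : c < t) : Continuous fun x => w x * (h x t : ℂ) := by
    refine hw.mul (Complex.continuous_ofReal.comp ?_)
    exact hh.comp_continuous (f := fun x => (x, t)) (by fun_prop) fun x => ⟨mem_univ _, ht⟩
  set δ := (y - c) / 2 with hδ
  have hδ0 : 0 < δ := by rw [hδ]; linarith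
  have hcomp : IsCompact (Icc (0 : ℝ) 1 ×ˢ Icc (y - δ) (y + δ)) := isCompact_Icc.prod isCompact_Icc
  have hcont : ContinuousOn (fun p : ℝ × ℝ => w p.1 * (g' p.1 p.2 : ℂ))
      (Icc (0 : ℝ) 1 ×ˢ Icc (y - δ) (y + δ)) := by
    refine (hw.comp continuous_fst).continuousOn.mul
      (Complex.continuous_ofReal.comp_continuousOn (hg'.mono ?_))
    refine prod_mono (subset_univ _) fun t ht => ?_
    have := ht.1
    simp only [mem_Ioi]
    linarith
  obtain ⟨M, hM⟩ := hcomp.exists_bound_of_continuousOn hcont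
  refine (intervalIntegral.hasDerivAt_integral_of_dominated_loc_of_deriv_le
    (F := fun y x => w x * (g x y : ℂ)) (F' := fun y x => w x * (g' x y : ℂ))
    (s := Ioo (y - δ) (y + δ)) (bound := fun _ => M) (Ioo_mem_nhds (by linarith) (by linarith))
    ?_ ((hslice hg hy).intervalIntegrable _ _) (hslice hg' hy).aestronglyMeasurable ?_ (by simp)
    ?_).2
  · filter_upwards [lt_mem_nhds hy] with t ht
    exact (hslice hg ht).aestronglyMeasurable
  · refine Eventually.of_forall fun x hx t ht => hM (x, t) ⟨?_, Ioo_subset_Icc_self ht⟩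
    rw [uIoc_of_le zero_le_one] at hx
    exact Ioc_subset_Icc_self hx
  · refine Eventually.of_forall fun x _ t ht => ?_
    exact ((hgd x t (by have := ht.1; linarith)).ofReal_comp).const_mul (w x)

lemma integral_mul_deriv_of_periodic {v v' : ℝ → ℝ} {w : ℝ → ℂ} {μ : ℂ}
    (hw : ∀ x, HasDerivAt w (μ * w x) x) (hw1 : w 1 = w 0) (hv1 : v 1 = v 0)
    (hv : ∀ x, HasDerivAt v (v' x) x) (hv' : Continuous v') :
    ∫ x in (0 : ℝ)..1, w x * v' x = -μ * ∫ x in (0 : ℝ)..1, w x * v x := by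
  have hwc : Continuous w := continuous_iff_continuousAt.2 fun x => (hw x).continuousAt
  rw [intervalIntegral.integral_mul_deriv_eq_deriv_mul (u := w) (v := fun x => (v x : ℂ))
    (v' := fun x => (v' x : ℂ)) (fun x _ => hw x) (fun x _ => (hv x).ofReal_comp)
    ((hwc.const_mul μ).intervalIntegrable _ _)
    ((Complex.continuous_ofReal.comp hv').intervalIntegrable _ _), hw1, hv1]
  simp_rw [mul_assoc μ]
  rw [intervalIntegral.integral_const_mul]
  ring

lemma hasDerivAt_fst_of_contDiffOn {c : ℝ} {u : ℝ → ℝ → ℝ}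
    (hu : ContDiffOn ℝ (⊤ : ℕ∞) (Function.uncurry u) (univ ×ˢ Ioi c)) {x y : ℝ} (hy : c < y) :
    HasDerivAt (fun s => u s y) (fderiv ℝ (Function.uncurry u) (x, y) (1, 0)) x := by
  have hd : HasFDerivAt (Function.uncurry u) (fderiv ℝ (Function.uncurry u) (x, y)) (x, y) :=
    ((hu.contDiffAt ((isOpen_univ.prod isOpen_Ioi).mem_nhds ⟨mem_univ x, mem_Ioi.2 hy⟩)).differentiableAt
      (by simp)).hasFDerivAt
  exact hd.comp_hasDerivAt x ((hasDerivAt_id x).prodMk (hasDerivAt_const x y))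

lemma hasDerivAt_snd_of_contDiffOn {c : ℝ} {u : ℝ → ℝ → ℝ}
    (hu : ContDiffOn ℝ (⊤ : ℕ∞) (Function.uncurry u) (univ ×ˢ Ioi c)) {x y : ℝ} (hy : c < y) :
    HasDerivAt (fun t => u x t) (fderiv ℝ (Function.uncurry u) (x, y) (0, 1)) y := by
  have hd : HasFDerivAt (Function.uncurry u) (fderiv ℝ (Function.uncurry u) (x, y)) (x, y) :=
    ((hu.contDiffAt ((isOpen_univ.prod isOpen_Ioi).mem_nhds ⟨mem_univ x, mem_Ioi.2 hy⟩)).differentiableAt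
      (by simp)).hasFDerivAt
  exact hd.comp_hasDerivAt y ((hasDerivAt_const y x).prodMk (hasDerivAt_id y))

lemma contDiffOn_fderiv_apply {c : ℝ} {u : ℝ → ℝ → ℝ}
    (hu : ContDiffOn ℝ (⊤ : ℕ∞) (Function.uncurry u) (univ ×ˢ Ioi c)) (e : ℝ × ℝ) :
    ContDiffOn ℝ (⊤ : ℕ∞) (fun p => fderiv ℝ (Function.uncurry u) p e) (univ ×ˢ Ioi c) :=
  (hu.fderiv_of_isOpen (isOpen_univ.prod isOpen_Ioi) (by simp)).clm_apply contDiffOn_const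

lemma contDiffOn_deriv_fst {c : ℝ} {u : ℝ → ℝ → ℝ}
    (hu : ContDiffOn ℝ (⊤ : ℕ∞) (Function.uncurry u) (univ ×ˢ Ioi c)) :
    ContDiffOn ℝ (⊤ : ℕ∞) (Function.uncurry fun x y => deriv (fun s => u s y) x)
      (univ ×ˢ Ioi c) :=
  (contDiffOn_fderiv_apply hu (1, 0)).congr fun _ hp => (hasDerivAt_fst_of_contDiffOn hu hp.2).deriv

lemma contDiffOn_deriv_snd {c : ℝ} {u : ℝ → ℝ → ℝ}
    (hu : ContDiffOn ℝ (⊤ : ℕ∞) (Function.uncurry u) (univ ×ˢ Ioi c)) :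
    ContDiffOn ℝ (⊤ : ℕ∞) (Function.uncurry fun x y => deriv (fun t => u x t) y)
      (univ ×ˢ Ioi c) :=
  (contDiffOn_fderiv_apply hu (0, 1)).congr fun _ hp => (hasDerivAt_snd_of_contDiffOn hu hp.2).deriv

/-! ### Decaying trigonometric series -/

/-- The mode `(a sin(lx) + b cos(lx)) exp(-l(y - c))` with `l = 2π(k + 1)`. -/
noncomputable def decayingMode (c : ℝ) (a b : ℕ → ℝ) (k : ℕ) (x y : ℝ) : ℝ :=
  (a k * Real.sin (2 * π * (k + 1) * x) + b k * Real.cos (2 * π * (k + 1) * x))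
    * Real.exp (-(2 * π * (k + 1)) * (y - c))

/-- The sequence `a` grows at most polynomially. -/
def HasPolynomialGrowth (a : ℕ → ℝ) : Prop :=
  ∃ (C : ℝ) (p : ℕ), 0 ≤ C ∧ ∀ k : ℕ, |a k| ≤ C * ((k : ℝ) + 1) ^ p

lemma HasPolynomialGrowth.const_mul_add_one {a : ℕ → ℝ} (ha : HasPolynomialGrowth a) (r : ℝ) :
    HasPolynomialGrowth fun k => r * (k + 1) * a k := by
  obtain ⟨C, p, hC, h⟩ := ha
  refine ⟨|r| * C, p + 1, by positivity, fun k => ?_⟩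
  rw [abs_mul, abs_mul, abs_of_nonneg (by positivity : (0 : ℝ) ≤ (k : ℝ) + 1)]
  calc |r| * ((k : ℝ) + 1) * |a k| ≤ |r| * ((k : ℝ) + 1) * (C * ((k : ℝ) + 1) ^ p) := by
        gcongr; exact h k
    _ = _ := by ring

/-- Modes with polynomially growing coefficients are dominated, uniformly for `y₀ ≤ y`, by a
summable sequence which decays exponentially in `y`. -/
lemma exists_summable_bound_decayingMode {c : ℝ} {a b : ℕ → ℝ} (ha : HasPolynomialGrowth a)
    (hb : HasPolynomialGrowth b) {y₀ : ℝ} (hy₀ : c < y₀) :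
    ∃ B : ℕ → ℝ, Summable B ∧ ∀ k x y, y₀ ≤ y →
      |decayingMode c a b k x y| ≤ B k * exp (-(2 * π) * (y - c)) := by
  obtain ⟨C, p, hC, h⟩ := ha
  obtain ⟨D, q, hD, h'⟩ := hb
  set r := 2 * π * (y₀ - c) with hr
  have hr0 : 0 < r := by have := pi_pos; have := sub_pos.2 hy₀; positivity
  have hS (p : ℕ) : Summable fun k : ℕ => ((k : ℝ) + 1) ^ p * exp (-r * k) := by
    have h1 := (summable_nat_add_iff 1).2 (Real.summable_pow_mul_exp_neg_nat_mul p hr0)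
    refine (h1.mul_left (exp r)).congr fun k => ?_
    push_cast
    rw [mul_left_comm, ← Real.exp_add]
    ring_nf
  refine ⟨fun k => C * (((k : ℝ) + 1) ^ p * exp (-r * k)) + D * (((k : ℝ) + 1) ^ q * exp (-r * k)),
    ((hS p).mul_left C).add ((hS q).mul_left D), fun k x y hy => ?_⟩
  have hexp : exp (-(2 * π * ((k : ℝ) + 1)) * (y - c))
      ≤ exp (-r * k) * exp (-(2 * π) * (y - c)) := by
    rw [← Real.exp_add]
    refine Real.exp_le_exp.2 ?_
    have : 0 ≤ 2 * π * k * (y - y₀) := by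
      have := pi_pos; have := sub_nonneg.2 hy; positivity
    rw [hr]
    linarith
  have hcoef : |a k * Real.sin (2 * π * (k + 1) * x) + b k * Real.cos (2 * π * (k + 1) * x)|
      ≤ C * ((k : ℝ) + 1) ^ p + D * ((k : ℝ) + 1) ^ q := by
    refine (abs_add_le _ _).trans (add_le_add ?_ ?_)
    · rw [abs_mul]
      exact (mul_le_of_le_one_right (abs_nonneg _) (abs_sin_le_one _)).trans (h k)
    · rw [abs_mul]
      exact (mul_le_of_le_one_right (abs_nonneg _) (abs_cos_le_one _)).trans (h' k)
  rw [decayingMode, abs_mul, abs_of_pos (exp_pos _)]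
  refine (mul_le_mul hcoef hexp (exp_pos _).le (by positivity)).trans (le_of_eq ?_)
  ring

lemma summable_decayingMode {c : ℝ} {a b : ℕ → ℝ} (ha : HasPolynomialGrowth a)
    (hb : HasPolynomialGrowth b) (x : ℝ) {y : ℝ} (hy : c < y) :
    Summable fun k => decayingMode c a b k x y := by
  obtain ⟨B, hB, h⟩ := exists_summable_bound_decayingMode ha hb hy
  exact .of_norm_bounded (hB.mul_right _) fun k => h k x y le_rfl

lemma exists_abs_tsum_decayingMode_le {c : ℝ} {a b : ℕ → ℝ} (ha : HasPolynomialGrowth a)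
    (hb : HasPolynomialGrowth b) :
    ∃ C : ℝ, 0 < C ∧ ∀ x y, c + 1 ≤ y →
      |∑' k, decayingMode c a b k x y| ≤ C * exp (-(2 * π) * (y - c)) := by
  obtain ⟨B, hB, h⟩ := exists_summable_bound_decayingMode (c := c) ha hb (lt_add_one c)
  refine ⟨|∑' k, B k| + 1, by positivity, fun x y hy => ?_⟩
  calc |∑' k, decayingMode c a b k x y| ≤ ∑' k, B k * exp (-(2 * π) * (y - c)) := by
        rw [← Real.norm_eq_abs]
        exact tsum_of_norm_bounded (hB.mul_right _).hasSum fun k => h k x y hy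
    _ = (∑' k, B k) * exp (-(2 * π) * (y - c)) := tsum_mul_right
    _ ≤ _ := by
        gcongr
        exact (le_abs_self _).trans (le_add_of_nonneg_right zero_le_one)

lemma hasDerivAt_decayingMode_fst (c : ℝ) (a b : ℕ → ℝ) (k : ℕ) (x y : ℝ) :
    HasDerivAt (fun s => decayingMode c a b k s y)
      (decayingMode c (fun k => -(2 * π) * (k + 1) * b k) (fun k => 2 * π * (k + 1) * a k) k x y)
      x := by
  have hl : HasDerivAt (fun s : ℝ => 2 * π * ((k : ℝ) + 1) * s) (2 * π * ((k : ℝ) + 1) * 1) x :=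
    (hasDerivAt_id x).const_mul _
  refine (((hl.sin.const_mul (a k)).add (hl.cos.const_mul (b k))).mul_const _).congr_deriv ?_
  simp only [decayingMode]
  ring

lemma hasDerivAt_decayingMode_snd (c : ℝ) (a b : ℕ → ℝ) (k : ℕ) (x y : ℝ) :
    HasDerivAt (fun t => decayingMode c a b k x t)
      (decayingMode c (fun k => -(2 * π) * (k + 1) * a k) (fun k => -(2 * π) * (k + 1) * b k) k x y)
      y := by
  have hl : HasDerivAt (fun t : ℝ => -(2 * π * ((k : ℝ) + 1)) * (t - c))
      (-(2 * π * ((k : ℝ) + 1)) * 1) y :=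
    ((hasDerivAt_id y).sub_const c).const_mul _
  refine (hl.exp.const_mul _).congr_deriv ?_
  simp only [decayingMode]
  ring

lemma hasDerivAt_tsum_decayingMode_fst {c : ℝ} {a b : ℕ → ℝ} (ha : HasPolynomialGrowth a)
    (hb : HasPolynomialGrowth b) (x : ℝ) {y : ℝ} (hy : c < y) :
    HasDerivAt (fun s => ∑' k, decayingMode c a b k s y)
      (∑' k, decayingMode c (fun k => -(2 * π) * (k + 1) * b k)
        (fun k => 2 * π * (k + 1) * a k) k x y) x := by
  obtain ⟨B, hB, h⟩ := exists_summable_bound_decayingMode (hb.const_mul_add_one (-(2 * π)))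
    (ha.const_mul_add_one (2 * π)) hy
  exact hasDerivAt_tsum_of_isPreconnected (hB.mul_right (exp (-(2 * π) * (y - c)))) isOpen_univ
    isPreconnected_univ (fun k s _ => hasDerivAt_decayingMode_fst c a b k s y)
    (fun k s _ => h k s y le_rfl) (mem_univ x) (summable_decayingMode ha hb x hy) (mem_univ x)

lemma hasDerivAt_tsum_decayingMode_snd {c : ℝ} {a b : ℕ → ℝ} (ha : HasPolynomialGrowth a)
    (hb : HasPolynomialGrowth b) (x : ℝ) {y : ℝ} (hy : c < y) :
    HasDerivAt (fun t => ∑' k, decayingMode c a b k x t)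
      (∑' k, decayingMode c (fun k => -(2 * π) * (k + 1) * a k)
        (fun k => -(2 * π) * (k + 1) * b k) k x y) y := by
  obtain ⟨y₀, hy₀, hy₀y⟩ := exists_between hy
  obtain ⟨B, hB, h⟩ := exists_summable_bound_decayingMode (ha.const_mul_add_one (-(2 * π)))
    (hb.const_mul_add_one (-(2 * π))) hy₀
  have hB0 (k : ℕ) : 0 ≤ B k :=
    nonneg_of_mul_nonneg_left ((abs_nonneg _).trans (h k 0 y₀ le_rfl)) (exp_pos _)
  refine hasDerivAt_tsum_of_isPreconnected hB (isOpen_Ioi (a := y₀))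
    isPreconnected_Ioi (fun k t _ => hasDerivAt_decayingMode_snd c a b k x t)
    (fun k t ht => (h k x t (le_of_lt ht)).trans (mul_le_of_le_one_right (hB0 k) ?_)) hy₀y
    (summable_decayingMode ha hb x hy) hy₀y
  rw [Real.exp_le_one_iff]
  have : 0 ≤ 2 * π * (t - c) := by
    have := pi_pos; have : 0 ≤ t - c := by have := mem_Ioi.1 ht; linarith
    positivity
  linarith

lemma iterate_deriv_snd_eq_tsum {c A : ℝ} {a b : ℕ → ℝ} {u : ℝ → ℝ → ℝ}
    (ha : HasPolynomialGrowth a) (hb : HasPolynomialGrowth b)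
    (hu : ∀ x y, c < y → u x y = A + ∑' k, decayingMode c a b k x y) (n : ℕ) :
    ∃ a' b' : ℕ → ℝ, HasPolynomialGrowth a' ∧ HasPolynomialGrowth b' ∧ ∀ x y, c < y →
      deriv^[n] (fun t => u x t) y
        = (if n = 0 then A else 0) + ∑' k, decayingMode c a' b' k x y := by
  induction n with
  | zero => exact ⟨a, b, ha, hb, fun x y hy => by simpa using hu x y hy⟩
  | succ n ih =>
    obtain ⟨a', b', ha', hb', h⟩ := ih
    refine ⟨_, _, ha'.const_mul_add_one (-(2 * π)), hb'.const_mul_add_one (-(2 * π)),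
      fun x y hy => ?_⟩
    rw [Function.iterate_succ_apply', if_neg n.succ_ne_zero, zero_add]
    refine HasDerivAt.deriv (((hasDerivAt_tsum_decayingMode_snd ha' hb' x hy).const_add
      (if n = 0 then A else 0)).congr_of_eventuallyEq ?_)
    filter_upwards [lt_mem_nhds hy] with t ht
    exact h x t ht

lemma iterate_deriv_fst_eq_tsum {c A : ℝ} {a b : ℕ → ℝ}
    (ha : HasPolynomialGrowth a) (hb : HasPolynomialGrowth b) (m : ℕ) :
    ∃ a' b' : ℕ → ℝ, HasPolynomialGrowth a' ∧ HasPolynomialGrowth b' ∧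
      ∀ (v : ℝ → ℝ) (y : ℝ), c < y → (∀ x, v x = A + ∑' k, decayingMode c a b k x y) →
      ∀ x, deriv^[m] v x = (if m = 0 then A else 0) + ∑' k, decayingMode c a' b' k x y := by
  induction m with
  | zero => exact ⟨a, b, ha, hb, fun v y hy hv x => by simpa using hv x⟩
  | succ m ih =>
    obtain ⟨a', b', ha', hb', h⟩ := ih
    refine ⟨_, _, hb'.const_mul_add_one (-(2 * π)), ha'.const_mul_add_one (2 * π),
      fun v y hy hv x => ?_⟩
    rw [Function.iterate_succ_apply', if_neg m.succ_ne_zero, zero_add]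
    rw [funext (h v y hy hv)]
    exact ((hasDerivAt_tsum_decayingMode_fst ha' hb' x hy).const_add _).deriv

/-! ### Fourier coefficients of bounded harmonic functions -/

lemma exists_integral_fourier_mul_eq {c : ℝ} {u : ℝ → ℝ → ℝ}
    (hper : ∀ x y, u (x + 1) y = u x y)
    (hsmooth : ContDiffOn ℝ (⊤ : ℕ∞) (Function.uncurry u) (univ ×ˢ Ioi c))
    (hharm : ∀ x y, c < y →
      deriv (fun s => deriv (fun s' => u s' y) s) x
        + deriv (fun t => deriv (fun t' => u x t') t) y = 0)
    (hbdd : ∀ x y, c < y → |u x y| ≤ 1) (k : ℤ) :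
    ∃ d : ℂ, ‖d‖ ≤ 1 ∧ ∀ y, c < y →
      ∫ x in (0 : ℝ)..1, fourier (-k) (x : AddCircle (1 : ℝ)) * (u x y : ℂ)
        = d * (exp (-(2 * π * |(k : ℝ)|) * (y - c)) : ℝ) := by
  set w : ℝ → ℂ := fun x => fourier (-k) (x : AddCircle (1 : ℝ)) with hw
  set μ : ℂ := -2 * π * Complex.I * k with hμ
  have hwd (x : ℝ) : HasDerivAt w (μ * w x) x := by
    simpa [hw, hμ] using hasDerivAt_fourier_neg (1 : ℝ) k x
  have hwc : Continuous w := continuous_iff_continuousAt.2 fun x => (hwd x).continuousAt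
  have hw1 : w 1 = w 0 := by
    simp only [hw]
    rw [AddCircle.coe_period]
    simp
  have hwn (x : ℝ) : ‖w x‖ = 1 := by
    simp only [hw, fourier_apply]
    exact Circle.norm_coe _
  set ux : ℝ → ℝ → ℝ := fun x y => deriv (fun s => u s y) x with hux
  set uxx : ℝ → ℝ → ℝ := fun x y => deriv (fun s => ux s y) x with huxx
  set uy : ℝ → ℝ → ℝ := fun x y => deriv (fun t => u x t) y with huy
  set uyy : ℝ → ℝ → ℝ := fun x y => deriv (fun t => uy x t) y with huyy
  have cux := contDiffOn_deriv_fst hsmooth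
  have cuxx := contDiffOn_deriv_fst cux
  have cuy := contDiffOn_deriv_snd hsmooth
  have cuyy := contDiffOn_deriv_snd cuy
  have hb (y : ℝ) (hy : c < y) : ‖∫ x in (0 : ℝ)..1, w x * (u x y : ℂ)‖ ≤ 1 := by
    refine (intervalIntegral.norm_integral_le_of_norm_le_const (C := 1) fun x _ => ?_).trans
      (by simp)
    rw [norm_mul, hwn, one_mul, Complex.norm_real]
    exact hbdd x y hy
  have h1 (y : ℝ) (hy : c < y) := hasDerivAt_integral_mul_of_continuousOn hwc
    hsmooth.continuousOn cuy.continuousOn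
    (fun x y hy => (hasDerivAt_snd_of_contDiffOn hsmooth hy).differentiableAt.hasDerivAt) hy
  have h2 (y : ℝ) (hy : c < y) := hasDerivAt_integral_mul_of_continuousOn hwc
    cuy.continuousOn cuyy.continuousOn
    (fun x y hy => (hasDerivAt_snd_of_contDiffOn cuy hy).differentiableAt.hasDerivAt) hy
  have hslice {v : ℝ → ℝ → ℝ}
      (hv : ContDiffOn ℝ (⊤ : ℕ∞) (Function.uncurry v) (univ ×ˢ Ioi c)) {y : ℝ} (hy : c < y) :
      Continuous fun x => v x y :=
    hv.continuousOn.comp_continuous (f := fun x => (x, y)) (by fun_prop)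
      fun x => ⟨mem_univ _, hy⟩
  have hkey (y : ℝ) (hy : c < y) : ∫ x in (0 : ℝ)..1, w x * (uyy x y : ℂ)
      = (2 * π * |(k : ℝ)| : ℝ) ^ 2 * ∫ x in (0 : ℝ)..1, w x * (u x y : ℂ) := by
    have e1 : ∫ x in (0 : ℝ)..1, w x * (ux x y : ℂ)
        = -μ * ∫ x in (0 : ℝ)..1, w x * (u x y : ℂ) :=
      integral_mul_deriv_of_periodic (v := fun x => u x y) hwd hw1 (by simpa using hper 0 y)
        (fun x => (hasDerivAt_fst_of_contDiffOn hsmooth hy).differentiableAt.hasDerivAt)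
        (hslice cux hy)
    have hperx : ux 1 y = ux 0 y := by
      have h : (fun s => u (s + 1) y) = fun s => u s y := funext fun s => hper s y
      have h' := deriv_comp_add_const (fun s => u s y) 1 0
      rw [h, zero_add] at h'
      exact h'.symm
    have e2 : ∫ x in (0 : ℝ)..1, w x * (uxx x y : ℂ)
        = -μ * ∫ x in (0 : ℝ)..1, w x * (ux x y : ℂ) :=
      integral_mul_deriv_of_periodic (v := fun x => ux x y) hwd hw1 hperx
        (fun x => (hasDerivAt_fst_of_contDiffOn cux hy).differentiableAt.hasDerivAt)
        (hslice cuxx hy)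
    have e3 (x : ℝ) : uyy x y = -uxx x y := by linarith [hharm x y hy]
    have hμ2 : -(μ * μ) = ((2 * π * |(k : ℝ)| : ℝ) : ℂ) ^ 2 := by
      rw [← Complex.ofReal_pow, mul_pow, sq_abs, hμ]
      push_cast
      linear_combination (-4 * (π : ℂ) ^ 2 * (k : ℂ) ^ 2) * Complex.I_sq
    simp_rw [e3, Complex.ofReal_neg, mul_neg]
    rw [intervalIntegral.integral_neg, e2, e1, ← hμ2]
    ring
  rcases eq_or_ne k 0 with hk | hk
  · obtain ⟨d, hd, h⟩ := eq_const_of_hasDerivAt_of_bounded h1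
      (fun y hy => (h2 y hy).congr_deriv ((hkey y hy).trans (by simp [hk]))) hb
    exact ⟨d, hd, fun y hy => by rw [h y hy]; simp [hk]⟩
  · have hl : 0 < 2 * π * |(k : ℝ)| := by
      have : (k : ℝ) ≠ 0 := by exact_mod_cast hk
      have := pi_pos
      positivity
    exact eq_exp_of_hasDerivAt_of_bounded hl h1
      (fun y hy => (h2 y hy).congr_deriv (hkey y hy)) hb

lemma hasSum_fourier_of_integral_eq {c : ℝ} {v : ℝ → ℝ} (hv : Continuous v)
    (hper : ∀ x, v (x + 1) = v x) {d : ℤ → ℂ} (hd : ∀ k, ‖d k‖ ≤ 1) {y : ℝ} (hy : c < y)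
    (h : ∀ k : ℤ, ∫ x in (0 : ℝ)..1, fourier (-k) (x : AddCircle (1 : ℝ)) * (v x : ℂ)
      = d k * (exp (-(2 * π * |(k : ℝ)|) * (y - c)) : ℝ)) (x : ℝ) :
    HasSum (fun k : ℤ => d k * (exp (-(2 * π * |(k : ℝ)|) * (y - c)) : ℝ)
      * fourier k (x : AddCircle (1 : ℝ))) (v x) := by
  have hp : Function.Periodic (fun x => (v x : ℂ)) 1 := fun x => by simp [hper]
  let f : C(AddCircle (1 : ℝ), ℂ) :=
    ⟨hp.lift, continuous_coinduced_dom.2 (Complex.continuous_ofReal.comp hv)⟩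
  have hf (k : ℤ) : fourierCoeff f k = d k * (exp (-(2 * π * |(k : ℝ)|) * (y - c)) : ℝ) := by
    rw [fourierCoeff_eq_intervalIntegral f k 0, ← h k]
    simp only [div_one, one_smul, zero_add, smul_eq_mul]
    rfl
  have hs : Summable fun k : ℤ => exp (-(2 * π * |(k : ℝ)|) * (y - c)) := by
    have hr : 0 < 2 * π * (y - c) := by
      have := pi_pos; have := sub_pos.2 hy; positivity
    have hn : Summable fun n : ℕ => exp (-(2 * π * n) * (y - c)) :=
      (Real.summable_pow_mul_exp_neg_nat_mul 0 hr).congr fun n => by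
        rw [pow_zero, one_mul]; ring_nf
    exact .of_nat_of_neg (by simpa using hn) (by simpa using hn)
  have hsum : Summable (fourierCoeff f) := .of_norm_bounded hs fun k => by
    rw [hf, norm_mul, Complex.norm_real, Real.norm_of_nonneg (exp_pos _).le]
    exact mul_le_of_le_one_left (exp_pos _).le (hd k)
  have := has_pointwise_sum_fourier_series_of_summable hsum (x : AddCircle (1 : ℝ))
  simp only [hf, smul_eq_mul] at this
  exact this

lemma eq_add_tsum_decayingMode_of_hasSum {c x y : ℝ} {r : ℝ} {d : ℤ → ℂ}
    (h : HasSum (fun k : ℤ => d k * (exp (-(2 * π * |(k : ℝ)|) * (y - c)) : ℝ)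
      * fourier k (x : AddCircle (1 : ℝ))) r) :
    r = (d 0).re + ∑' k, decayingMode c (fun k : ℕ => (d (-(k + 1))).im - (d (k + 1)).im)
      (fun k : ℕ => (d (k + 1)).re + (d (-(k + 1))).re) k x y := by
  have h1 := (hasSum_nat_add_iff' 1).2 h.nat_add_neg
  have h2 := Complex.hasSum_re h1
  have hterm (k : ℕ) (z z' : ℂ) (E : ℝ) : (z * E * fourier ((k : ℤ) + 1) (x : AddCircle (1 : ℝ))
      + z' * E * fourier (-((k : ℤ) + 1)) (x : AddCircle (1 : ℝ))).re
      = ((z'.im - z.im) * Real.sin (2 * π * (k + 1) * x)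
        + (z.re + z'.re) * Real.cos (2 * π * (k + 1) * x)) * E := by
    have hexp : (fourier ((k : ℤ) + 1) (x : AddCircle (1 : ℝ)) : ℂ)
        = Complex.exp ((2 * π * (k + 1) * x : ℝ) * Complex.I) := by
      rw [fourier_coe_apply]
      congr 1
      push_cast
      ring
    rw [fourier_neg, hexp]
    simp only [Complex.add_re, Complex.mul_re, Complex.mul_im, Complex.conj_re, Complex.conj_im,
      Complex.exp_ofReal_mul_I_re, Complex.exp_ofReal_mul_I_im, Complex.ofReal_re,
      Complex.ofReal_im]
    ring
  have h3 : HasSum (fun k => decayingMode c (fun k : ℕ => (d (-(k + 1))).im - (d (k + 1)).im)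
      (fun k : ℕ => (d (k + 1)).re + (d (-(k + 1))).re) k x y) (r - (d 0).re) := by
    convert h2 using 1
    · funext k
      have habs : |((k : ℝ) + 1)| = k + 1 := abs_of_nonneg (by positivity)
      have := hterm k (d (k + 1)) (d (-(k + 1))) (exp (-(2 * π * (k + 1)) * (y - c)))
      rw [decayingMode, ← this]
      simp only [Nat.cast_add, Nat.cast_one, Int.cast_neg, Int.cast_add, Int.cast_natCast,
        Int.cast_one, abs_neg, habs]
    · simp
  rw [h3.tsum_eq]
  ring

/-- A bounded harmonic function on `𝕋 × (c, ∞)` has a Fourier representation, and all derivatives of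
its difference with the constant term decay exponentially. -/
theorem fourier_representation_halfcylinder (c : ℝ) (u : ℝ → ℝ → ℝ)
    (hper : ∀ x y, u (x + 1) y = u x y)
    (hsmooth : ContDiffOn ℝ (⊤ : ℕ∞) (Function.uncurry u) (univ ×ˢ Ioi c))
    (hharm : ∀ x y, c < y →
      deriv (fun s => deriv (fun s' => u s' y) s) x
        + deriv (fun t => deriv (fun t' => u x t') t) y = 0)
    (hbdd : ∀ x y, c < y → |u x y| ≤ 1) :
    ∃ a b : ℕ → ℝ,
      (∀ x y, c < y →
        u x y = a 0 + ∑' k : ℕ,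
          (a (k + 1) * Real.sin (2 * π * (k + 1) * x)
            + b (k + 1) * Real.cos (2 * π * (k + 1) * x))
            * Real.exp (-(2 * π * (k + 1)) * (y - c))) ∧
      (∀ m n : ℕ, ∃ C : ℝ, 0 < C ∧ ∀ x y, c + 1 ≤ y →
        |deriv^[m] (fun s => deriv^[n] (fun t => u s t) y) x
            - (if m = 0 ∧ n = 0 then a 0 else 0)|
          ≤ C * Real.exp (-(2 * π) * (y - c))) := by
  choose d hd hint using exists_integral_fourier_mul_eq hper hsmooth hharm hbdd
  set A : ℝ := (d 0).re
  set a : ℕ → ℝ := fun k => (d (-(k + 1))).im - (d (k + 1)).im with ha_def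
  set b : ℕ → ℝ := fun k => (d (k + 1)).re + (d (-(k + 1))).re with hb_def
  have hre (k : ℤ) : |(d k).re| ≤ 1 := (Complex.abs_re_le_norm _).trans (hd k)
  have him (k : ℤ) : |(d k).im| ≤ 1 := (Complex.abs_im_le_norm _).trans (hd k)
  have ha : HasPolynomialGrowth a := by
    refine ⟨2, 0, zero_le_two, fun k => ?_⟩
    have := abs_sub (d (-(k + 1))).im (d (k + 1)).im
    simp only [ha_def, pow_zero]
    linarith [him (-(k + 1)), him (k + 1)]
  have hb : HasPolynomialGrowth b := by
    refine ⟨2, 0, zero_le_two, fun k => ?_⟩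
    have := abs_add_le (d (k + 1)).re (d (-(k + 1))).re
    simp only [hb_def, pow_zero]
    linarith [hre (-(k + 1)), hre (k + 1)]
  have hu : ∀ x y, c < y → u x y = A + ∑' k, decayingMode c a b k x y := fun x y hy => by
    have hv : Continuous fun x => u x y :=
      hsmooth.continuousOn.comp_continuous (f := fun x => (x, y)) (by fun_prop)
        fun x => ⟨mem_univ _, hy⟩
    exact eq_add_tsum_decayingMode_of_hasSum
      (hasSum_fourier_of_integral_eq hv (fun x => hper x y) hd hy (fun k => hint k y hy) x)
  refine ⟨fun k => k.casesOn A a, fun k => k.casesOn 0 b, hu, fun m n => ?_⟩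
  obtain ⟨a₁, b₁, ha₁, hb₁, h₁⟩ := iterate_deriv_snd_eq_tsum ha hb hu n
  obtain ⟨a₂, b₂, ha₂, hb₂, h₂⟩ :=
    iterate_deriv_fst_eq_tsum (c := c) (A := if n = 0 then A else 0) ha₁ hb₁ m
  obtain ⟨C, hC, hbound⟩ := exists_abs_tsum_decayingMode_le (c := c) ha₂ hb₂
  refine ⟨C, hC, fun x y hy => ?_⟩
  have hcy : c < y := by linarith
  rw [h₂ _ y hcy (fun s => h₁ s y hcy) x, ← ite_and]
  change |(if m = 0 ∧ n = 0 then A else 0) + _ - (if m = 0 ∧ n = 0 then A else 0)| ≤ _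
  rw [add_sub_cancel_left]
  exact hbound x y hy
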